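/- There is a constant C > 0 such that for every small polymer X (a connected polymer consisting of at most 4 blocks) and every function f of class C² on a neighborhood of X: max{ sup_X |∇f|², sup_X |∇²f|² } ≤ C · ( ‖∇f‖²_{L²(X)} + ‖∇²f‖²_{B²_∞(X)} ). -/

import Mathlib

open MeasureTheory

noncomputable section

/-- The plane, with its Euclidean structure. -/
abbrev E2 := EuclideanSpace ℝ (Fin 2)

/-- The closed unit square (block) of the standard tessellation of `ℝ²` with lower-left
corner `p ∈ ℤ²`. -/
def unitSquare (p : ℤ × ℤ) : Set E2 :=
  {x | (p.1 : ℝ) ≤ x 0 ∧ x 0 ≤ (p.1 : ℝ) + 1 ∧ (p.2 : ℝ) ≤ x 1 ∧ x 1 ≤ (p.2 : ℝ) + 1}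

/-- The polymer (finite union of closed unit squares) indexed by a finite set `S ⊆ ℤ²`. -/
def polymerOf (S : Finset (ℤ × ℤ)) : Set E2 := ⋃ p ∈ S, unitSquare p

/-- `‖∇ⁿf(x)‖`, the norm of the `n`-th derivative of `f` at `x`. -/
def dNorm (n : ℕ) (f : E2 → ℝ) (x : E2) : ℝ := ‖iteratedFDeriv ℝ n f x‖

theorem volume_unitSquare_aux (p : ℤ × ℤ) : volume (unitSquare p) = 1 := by
  have h : unitSquare p = (WithLp.ofLp : E2 → (Fin 2 → ℝ)) ⁻¹'
      (Set.Icc ![(p.1 : ℝ), (p.2 : ℝ)] ![(p.1 : ℝ) + 1, (p.2 : ℝ) + 1]) := by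
    ext x
    simp only [unitSquare, Set.mem_ofPred_eq, Set.mem_preimage, Set.mem_Icc, Pi.le_def,
      Fin.forall_fin_two]
    simp
    tauto
  rw [h, (PiLp.volume_preserving_ofLp (Fin 2)).measure_preimage
    measurableSet_Icc.nullMeasurableSet, Real.volume_Icc_pi]
  simp

theorem isClosed_unitSquare_aux (p : ℤ × ℤ) : IsClosed (unitSquare p) := by
  have h0 : Continuous fun x : E2 => x 0 := by fun_prop
  have h1 : Continuous fun x : E2 => x 1 := by fun_prop
  exact (isClosed_le continuous_const h0).inter ((isClosed_le h0 continuous_const).inter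
    ((isClosed_le continuous_const h1).inter (isClosed_le h1 continuous_const)))

theorem dist_unitSquare_aux (p : ℤ × ℤ) {x y : E2} (hx : x ∈ unitSquare p)
    (hy : y ∈ unitSquare p) : ‖x - y‖ ≤ 2 := by
  obtain ⟨a, b, c, d⟩ := hx
  obtain ⟨a', b', c', d'⟩ := hy
  rw [EuclideanSpace.norm_eq, Real.sqrt_le_left (by norm_num)]
  simp only [Fin.sum_univ_two, Real.norm_eq_abs, sq_abs, PiLp.sub_apply]
  nlinarith

theorem isCompact_unitSquare_aux (p : ℤ × ℤ) : IsCompact (unitSquare p) := by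
  refine Metric.isCompact_of_isClosed_isBounded (isClosed_unitSquare_aux p) ?_
  refine Metric.isBounded_iff.2 ⟨2, fun x hx y hy => ?_⟩
  rw [dist_eq_norm]
  exact dist_unitSquare_aux p hx hy

theorem convex_unitSquare_aux (p : ℤ × ℤ) : Convex ℝ (unitSquare p) := by
  rintro x ⟨a, b, c, d⟩ y ⟨a', b', c', d'⟩ s t hs ht hst
  have ht' : t = 1 - s := by linarith
  subst ht'
  refine ⟨?_, ?_, ?_, ?_⟩ <;> simp only [PiLp.add_apply, PiLp.smul_apply, smul_eq_mul] <;> nlinarith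

/-- There is a constant `C > 0` such that for every small polymer `X` (connected, at
most 4 blocks) and every `f` of class `C²` on a neighborhood of `X`:
`max (sup_X |∇f|²) (sup_X |∇²f|²) ≤ C (‖∇f‖²_{L²(X)} + ‖∇²f‖²_{B²_∞(X)})`. -/
theorem stmt5 :
    ∃ C : ℝ, 0 < C ∧
      ∀ S : Finset (ℤ × ℤ), S.Nonempty → S.card ≤ 4 → IsConnected (polymerOf S) →
        ∀ (f : E2 → ℝ) (U : Set E2), IsOpen U → polymerOf S ⊆ U →
          ContDiffOn ℝ 2 f U →
          ∀ x ∈ polymerOf S,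
            max (dNorm 1 f x ^ 2) (dNorm 2 f x ^ 2) ≤
              C * ((∫ y in polymerOf S, dNorm 1 f y ^ 2) +
                   ∑ p ∈ S, ⨆ y ∈ unitSquare p, dNorm 2 f y ^ 2) := by
  refine ⟨8, by norm_num, ?_⟩
  intro S _ _ _ f U hU hSU hf x hx
  have hat : ∀ y ∈ U, ContDiffAt ℝ 2 f y := fun y hy => hf.contDiffAt (hU.mem_nhds hy)
  have hc1 : ContinuousOn (fun y => dNorm 1 f y ^ 2) U := fun y hy =>
    (((hat y hy).iteratedFDeriv_right (m := 0) (i := 1) (by norm_num)).continuousAt.norm.pow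
      2).continuousWithinAt
  have hc2 : ContinuousOn (fun y => dNorm 2 f y ^ 2) U := fun y hy =>
    (((hat y hy).iteratedFDeriv_right (m := 0) (i := 2) (by norm_num)).continuousAt.norm.pow
      2).continuousWithinAt
  have hd : ∀ y ∈ U, DifferentiableAt ℝ (iteratedFDeriv ℝ 1 f) y := fun y hy =>
    ((hat y hy).iteratedFDeriv_right (m := 1) (i := 1) (by norm_num)).differentiableAt (by norm_num)
  have hpS : ∀ p ∈ S, unitSquare p ⊆ polymerOf S := fun p hp =>
    Set.subset_biUnion_of_mem (u := fun p => unitSquare p) hp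
  have hpU : ∀ p ∈ S, unitSquare p ⊆ U := fun p hp => (hpS p hp).trans hSU
  have hcomp : IsCompact (polymerOf S) :=
    S.isCompact_biUnion fun p _ => isCompact_unitSquare_aux p
  have hnn : ∀ p : ℤ × ℤ, 0 ≤ ⨆ y ∈ unitSquare p, dNorm 2 f y ^ 2 := fun p =>
    Real.iSup_nonneg fun y => Real.iSup_nonneg fun _ => sq_nonneg _
  have hsup : ∀ p ∈ S, ∀ y ∈ unitSquare p,
      dNorm 2 f y ^ 2 ≤ ⨆ y ∈ unitSquare p, dNorm 2 f y ^ 2 := by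
    intro p hp y hy
    obtain ⟨K, hK⟩ := ((isCompact_unitSquare_aux p).image_of_continuousOn
      (hc2.mono (hpU p hp))).bddAbove
    have hb : BddAbove (Set.range fun y => ⨆ (_ : y ∈ unitSquare p), dNorm 2 f y ^ 2) := by
      refine ⟨max K 0, ?_⟩
      rintro _ ⟨z, rfl⟩
      refine Real.iSup_le (fun hz => ?_) (le_max_right _ _)
      exact (hK ⟨z, hz, rfl⟩).trans (le_max_left _ _)
    have := le_ciSup hb y
    simpa [hy] using this
  set A := ∑ p ∈ S, ⨆ y ∈ unitSquare p, dNorm 2 f y ^ 2 with hA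
  have hA0 : 0 ≤ A := Finset.sum_nonneg fun p _ => hnn p
  have hle : ∀ p ∈ S, ∀ y ∈ unitSquare p, dNorm 2 f y ^ 2 ≤ A := fun p hp y hy =>
    (hsup p hp y hy).trans
      (Finset.single_le_sum (f := fun p => ⨆ y ∈ unitSquare p, dNorm 2 f y ^ 2)
        (fun p _ => hnn p) hp)
  have hint : IntegrableOn (fun y => dNorm 1 f y ^ 2) (polymerOf S) :=
    (hc1.mono hSU).integrableOn_compact hcomp
  have hI0 : 0 ≤ ∫ y in polymerOf S, dNorm 1 f y ^ 2 :=
    integral_nonneg fun y => sq_nonneg _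
  obtain ⟨p, hp, hxp⟩ : ∃ p ∈ S, x ∈ unitSquare p := by
    simpa [polymerOf] using hx
  refine max_le ?_ (by linarith [hle p hp x hxp])
  have key : ∀ y ∈ unitSquare p, dNorm 1 f x ^ 2 - 8 * A ≤ 2 * dNorm 1 f y ^ 2 := by
    intro y hy
    have h1 : ‖iteratedFDeriv ℝ 1 f x - iteratedFDeriv ℝ 1 f y‖ ≤ √A * ‖x - y‖ := by
      refine (convex_unitSquare_aux p).norm_image_sub_le_of_norm_fderiv_le
        (𝕜 := ℝ) (fun z hz => hd z (hpU p hp hz)) (fun z hz => ?_) hy hxp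
      rw [norm_fderiv_iteratedFDeriv]
      exact Real.le_sqrt_of_sq_le (hle p hp z hz)
    have h2 := dist_unitSquare_aux p hxp hy
    have h3 : dNorm 1 f x ≤ dNorm 1 f y + 2 * √A := by
      have := norm_le_norm_add_norm_sub' (iteratedFDeriv ℝ 1 f x) (iteratedFDeriv ℝ 1 f y)
      have := mul_le_mul_of_nonneg_left h2 (Real.sqrt_nonneg A)
      simp only [dNorm]
      linarith
    have h4 : 0 ≤ dNorm 1 f x := norm_nonneg _
    have h5 := pow_le_pow_left₀ h4 h3 2
    have h6 := Real.sq_sqrt hA0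
    nlinarith [sq_nonneg (dNorm 1 f y - 2 * √A)]
  have hv := volume_unitSquare_aux p
  have hm := setIntegral_mono_on (μ := volume) (s := unitSquare p)
    (f := fun _ => dNorm 1 f x ^ 2 - 8 * A) (g := fun y => 2 * dNorm 1 f y ^ 2)
    (integrableOn_const (by simp [hv])) ((hint.mono_set (hpS p hp)).const_mul 2)
    (isClosed_unitSquare_aux p).measurableSet key
  rw [setIntegral_const, integral_const_mul] at hm
  simp only [Measure.real, hv, ENNReal.toReal_one, one_smul] at hm
  have hmono : ∫ y in unitSquare p, dNorm 1 f y ^ 2 ≤ ∫ y in polymerOf S, dNorm 1 f y ^ 2 :=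
    setIntegral_mono_set hint (Filter.Eventually.of_forall fun y => sq_nonneg _)
      (hpS p hp).eventuallyLE
  linarith

end
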